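/- arXiv:1908.05963 — 2 statements merged into one kernel-verified Lean document; each statement's English description precedes it below -/
import Mathlib

section
/- Let g be a finite-dimensional complex Lie algebra that is perfect, i.e. ⁅g, g⁆ = g. Then the solvable radical r of g is nilpotent (as a Lie algebra). -/
/-- The trace of the action of any element of a perfect Lie algebra vanishes. -/
lemma perfect_trace_toEnd_eq_zero
    {L : Type*} [LieRing L] [LieAlgebra ℂ L]
    (hperf : ⁅(⊤ : LieIdeal ℂ L), (⊤ : LieIdeal ℂ L)⁆ = ⊤)
    (V : Type*) [AddCommGroup V] [Module ℂ V] [LieRingModule L V] [LieModule ℂ L V]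
    (x : L) : LinearMap.trace ℂ V (LieModule.toEnd ℂ L V x) = 0 := by
  have hx : x ∈ (⁅(⊤ : LieIdeal ℂ L), (⊤ : LieIdeal ℂ L)⁆).toSubmodule := by
    rw [hperf]; trivial
  rw [LieSubmodule.lieIdeal_oper_eq_linear_span'] at hx
  induction hx using Submodule.span_induction with
  | mem x h =>
    obtain ⟨a, -, b, -, rfl⟩ := h
    have h : LieModule.toEnd ℂ L V ⁅a, b⁆ =
        LieModule.toEnd ℂ L V a * LieModule.toEnd ℂ L V b -
          LieModule.toEnd ℂ L V b * LieModule.toEnd ℂ L V a := by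
      ext v
      simp
    rw [h, map_sub, LinearMap.trace_mul_comm, sub_self]
  | zero => simp
  | add a b _ _ ha hb => simp [ha, hb]
  | smul c a _ ha => simp [ha]

/-- A solvable ideal of a perfect Lie algebra acts by nilpotent endomorphisms. -/
lemma perfect_isNilpotent_toEnd
    {L : Type*} [LieRing L] [LieAlgebra ℂ L] [FiniteDimensional ℂ L]
    (hperf : ⁅(⊤ : LieIdeal ℂ L), (⊤ : LieIdeal ℂ L)⁆ = ⊤)
    (I : LieIdeal ℂ L) [LieAlgebra.IsSolvable I] (n : ℕ) :
    ∀ (V : Type*) [AddCommGroup V] [Module ℂ V] [FiniteDimensional ℂ V]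
      [LieRingModule L V] [LieModule ℂ L V], Module.finrank ℂ V = n → ∀ r : I,
      ∃ k : ℕ, ∀ v : V, ((LieModule.toEnd ℂ L V (r : L)) ^ k) v = 0 := by
  induction n using Nat.strong_induction_on with
  | _ n ih =>
  intro V _ _ _ _ _ hn r
  cases subsingleton_or_nontrivial V with
  | inl h => exact ⟨0, fun v => Subsingleton.elim _ _⟩
  | inr h =>
  obtain ⟨χ, hχ⟩ := LieModule.exists_nontrivial_weightSpace_of_isSolvable ℂ I V
  let W : LieSubmodule ℂ L V := LieModule.weightSpaceOfIsLieTower ℂ V χ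
  have hW : Nontrivial W := hχ
  have hact (v : V) (hv : v ∈ W) : ⁅(r : L), v⁆ = χ r • v :=
    (LieModule.mem_weightSpace (M := V) χ v).1 hv r
  have hχr : χ r = 0 := by
    have h1 := perfect_trace_toEnd_eq_zero hperf W (r : L)
    have h2 : LieModule.toEnd ℂ L W (r : L) = χ r • LinearMap.id := by
      ext w
      simpa using hact w w.2
    rw [h2, map_smul, LinearMap.trace_id, smul_eq_mul, mul_eq_zero] at h1
    refine h1.resolve_right ?_
    exact_mod_cast (Module.finrank_pos (R := ℂ) (M := W)).ne'
  have hlt : Module.finrank ℂ (V ⧸ W) < n := by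
    have h1 := Submodule.finrank_quotient_add_finrank W.toSubmodule
    have h2 := Module.finrank_pos (R := ℂ) (M := W)
    have h3 : Module.finrank ℂ (V ⧸ W) = Module.finrank ℂ (V ⧸ W.toSubmodule) := rfl
    have h4 : Module.finrank ℂ W = Module.finrank ℂ W.toSubmodule := rfl
    omega
  have : FiniteDimensional ℂ (V ⧸ W) :=
    inferInstanceAs (FiniteDimensional ℂ (V ⧸ W.toSubmodule))
  obtain ⟨k, hk⟩ := ih _ hlt (V ⧸ W) rfl r
  refine ⟨k + 1, fun v => ?_⟩
  have hmk (j : ℕ) : ((LieModule.toEnd ℂ L (V ⧸ W) (r : L)) ^ j)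
      (LieSubmodule.Quotient.mk' W v) =
      LieSubmodule.Quotient.mk' W (((LieModule.toEnd ℂ L V (r : L)) ^ j) v) := by
    induction j with
    | zero => simp
    | succ j hj =>
      rw [pow_succ', pow_succ', Module.End.mul_apply, Module.End.mul_apply, hj,
        LieModule.toEnd_apply_apply, LieModule.toEnd_apply_apply, LieModuleHom.map_lie]
  have hmem : ((LieModule.toEnd ℂ L V (r : L)) ^ k) v ∈ W := by
    rw [← LieSubmodule.Quotient.mk_eq_zero, ← hmk, hk]
  rw [pow_succ', Module.End.mul_apply, LieModule.toEnd_apply_apply, hact _ hmem, hχr, zero_smul]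

/-- The solvable radical of a finite-dimensional perfect complex Lie algebra
is nilpotent as a Lie algebra. -/
theorem radical_isNilpotent_of_perfect
    (L : Type*) [LieRing L] [LieAlgebra ℂ L] [FiniteDimensional ℂ L]
    (hperf : ⁅(⊤ : LieIdeal ℂ L), (⊤ : LieIdeal ℂ L)⁆ = ⊤) :
    LieRing.IsNilpotent (LieAlgebra.radical ℂ L) := by
  rw [LieAlgebra.isNilpotent_iff_forall (R := ℂ)]
  intro r
  obtain ⟨k, hk⟩ := perfect_isNilpotent_toEnd hperf (LieAlgebra.radical ℂ L) _
    (LieAlgebra.radical ℂ L) rfl r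
  refine ⟨k, ?_⟩
  ext v
  have h : LieAlgebra.ad ℂ (LieAlgebra.radical ℂ L) r =
      LieModule.toEnd ℂ L (LieAlgebra.radical ℂ L) (r : L) := by
    ext w
    rfl
  rw [h, hk]
  rfl
end

section
/- Let g be a non-trivial finite-dimensional complex Lie algebra that is perfect (⁅g, g⁆ = g) and complete (the center Z(g) is trivial and every derivation of g is inner), and suppose g is not semisimple. Then the solvable radical r of g is nilpotent and non-abelian, i.e. r is nilpotent as a Lie algebra and ⁅r, r⁆ ≠ 0. -/
namespace RadAux
open LieModule LieAlgebra
attribute [local instance] LieRing.ofAssociativeRing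

/-- Elements of a perfect Lie algebra act with trace zero. -/
lemma trace_zero {L : Type*} [LieRing L] [LieAlgebra ℂ L]
    (hperf : ⁅(⊤ : LieIdeal ℂ L), (⊤ : LieIdeal ℂ L)⁆ = ⊤)
    {V : Type*} [AddCommGroup V] [Module ℂ V] [LieRingModule L V] [LieModule ℂ L V] (x : L) :
    LinearMap.trace ℂ V (toEnd ℂ L V x) = 0 := by
  have hx : x ∈ (⁅(⊤ : LieIdeal ℂ L), (⊤ : LieIdeal ℂ L)⁆ : LieIdeal ℂ L) := by
    rw [hperf]; exact LieSubmodule.mem_top x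
  rw [← LieSubmodule.mem_toSubmodule, LieSubmodule.lieIdeal_oper_eq_linear_span'] at hx
  induction hx using Submodule.span_induction with
  | mem u hu => obtain ⟨a, -, b, -, rfl⟩ := hu; simp
  | zero => simp
  | add u v _ _ hu hv => simp [hu, hv]
  | smul t u _ hu => simp [hu]

/-- The radical of a perfect Lie algebra kills some non-zero vector in any non-zero module. -/
lemma exists_killed {L : Type*} [LieRing L] [LieAlgebra ℂ L] [FiniteDimensional ℂ L]
    (hperf : ⁅(⊤ : LieIdeal ℂ L), (⊤ : LieIdeal ℂ L)⁆ = ⊤)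
    (V : Type*) [AddCommGroup V] [Module ℂ V] [LieRingModule L V] [LieModule ℂ L V]
    [FiniteDimensional ℂ V] [Nontrivial V] :
    ∃ N : LieSubmodule ℂ L V, Nontrivial N ∧ ∀ x ∈ radical ℂ L, ∀ v ∈ N, ⁅x, v⁆ = 0 := by
  obtain ⟨χ, hχ⟩ : ∃ χ : Module.Dual ℂ (radical ℂ L), Nontrivial (weightSpace V χ) :=
    exists_nontrivial_weightSpace_of_isSolvable ℂ (radical ℂ L) V
  let N : LieSubmodule ℂ L V := weightSpaceOfIsLieTower ℂ V χ
  replace hχ : Nontrivial N := hχ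
  have hN : ∀ m ∈ N, ∀ (y : L) (hy : y ∈ radical ℂ L), ⁅y, m⁆ = χ ⟨y, hy⟩ • m := by
    intro m hm
    simpa [N, weightSpaceOfIsLieTower, mem_weightSpace] using hm
  refine ⟨N, hχ, fun x hx v hv => ?_⟩
  rw [hN v hv x hx]
  have h1 : toEnd ℂ L N x = χ ⟨x, hx⟩ • LinearMap.id := by
    ext m
    simpa using hN m m.2 x hx
  have h2 := trace_zero hperf (V := N) x
  rw [h1] at h2
  have h3 : Module.finrank ℂ N ≠ 0 := Module.finrank_pos.ne'
  have h4 : χ ⟨x, hx⟩ = 0 := by simpa [h3] using h2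
  simp [h4]

lemma radical_acts_nilpotently {L : Type*} [LieRing L] [LieAlgebra ℂ L] [FiniteDimensional ℂ L]
    (hperf : ⁅(⊤ : LieIdeal ℂ L), (⊤ : LieIdeal ℂ L)⁆ = ⊤) (x : L) (hx : x ∈ radical ℂ L) (n : ℕ) :
    ∀ (V : Type _) [AddCommGroup V] [Module ℂ V] [LieRingModule L V] [LieModule ℂ L V]
    [FiniteDimensional ℂ V], Module.finrank ℂ V ≤ n → ∃ k, ∀ v : V, (toEnd ℂ L V x ^ k) v = 0 := by
  induction n with
  | zero =>
    intro V _ _ _ _ _ h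
    have : Subsingleton V := Module.finrank_zero_iff.mp (Nat.le_zero.mp h)
    exact ⟨0, fun v => Subsingleton.elim _ _⟩
  | succ n ih =>
    intro V _ _ _ _ _ h
    cases subsingleton_or_nontrivial V
    · exact ⟨0, fun v => Subsingleton.elim _ _⟩
    obtain ⟨N, hN, hkill⟩ := exists_killed hperf V
    have hfr : Module.finrank ℂ (V ⧸ N) + Module.finrank ℂ N = Module.finrank ℂ V :=
      Submodule.finrank_quotient_add_finrank N.toSubmodule
    have hpos : 0 < Module.finrank ℂ N := Module.finrank_pos
    have : FiniteDimensional ℂ (V ⧸ N) :=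
      inferInstanceAs (FiniteDimensional ℂ (V ⧸ N.toSubmodule))
    obtain ⟨k, hk⟩ := ih (V ⧸ N) (by omega)
    have hmk : ∀ (k : ℕ) (v : V), LieSubmodule.Quotient.mk' N ((toEnd ℂ L V x ^ k) v) =
        (toEnd ℂ L (V ⧸ N) x ^ k) (LieSubmodule.Quotient.mk' N v) := by
      intro k
      induction k with
      | zero => intro v; rfl
      | succ k ihk =>
        intro v
        rw [pow_succ', pow_succ', Module.End.mul_apply, Module.End.mul_apply, ← ihk]
        simp only [toEnd_apply_apply, LieModuleHom.map_lie]
    refine ⟨k + 1, fun v => ?_⟩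
    have : (toEnd ℂ L V x ^ k) v ∈ N := by
      rw [← LieSubmodule.Quotient.mk_eq_zero, hmk, hk]
    rw [pow_succ', Module.End.mul_apply]
    exact hkill x hx _ this

lemma radical_nilpotent {L : Type*} [LieRing L] [LieAlgebra ℂ L] [FiniteDimensional ℂ L]
    (hperf : ⁅(⊤ : LieIdeal ℂ L), (⊤ : LieIdeal ℂ L)⁆ = ⊤) :
    LieRing.IsNilpotent (radical ℂ L) := by
  rw [LieAlgebra.isNilpotent_iff_forall (R := ℂ)]
  rintro ⟨x, hx⟩
  apply LieSubalgebra.isNilpotent_ad_of_isNilpotent_ad (radical ℂ L : LieSubalgebra ℂ L)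
    (x := ⟨x, hx⟩)
  obtain ⟨k, hk⟩ := radical_acts_nilpotently hperf x hx _ L le_rfl
  exact ⟨k, LinearMap.ext hk⟩

/-- The Casimir operator. -/
lemma exists_casimir {L : Type*} [LieRing L] [LieAlgebra ℂ L] [FiniteDimensional ℂ L]
    {V : Type*} [AddCommGroup V] [Module ℂ V] [LieRingModule L V] [LieModule ℂ L V]
    [FiniteDimensional ℂ V] (I : LieIdeal ℂ L)
    (hnd : ∀ x ∈ I, (∀ y ∈ I, traceForm ℂ L V x y = 0) → x = 0) :
    ∃ c : Module.End ℂ V, (∀ (z : L) (v : V), c ⁅z, v⁆ = ⁅z, c v⁆) ∧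
      LinearMap.trace ℂ V c = Module.finrank ℂ I ∧
      ∀ l : V →ₗ[ℂ] ℂ, (∀ (x : L) (v : V), l ⁅x, v⁆ = 0) → ∀ v, l (c v) = 0 := by
  let B : LinearMap.BilinForm ℂ I := (traceForm ℂ L V).restrict I.toSubmodule
  have hB : ∀ x y : I, B x y = traceForm ℂ L V x y := fun _ _ => rfl
  have hsymm : B.IsSymm := ⟨fun x y => by simp only [hB]; exact traceForm_comm ..⟩
  have hBn : B.Nondegenerate := by
    rw [LinearMap.BilinForm.nondegenerate_iff_ker_eq_bot, LinearMap.ker_eq_bot'] 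
    intro m hm
    apply Subtype.ext
    exact hnd m m.2 fun y hy => LinearMap.congr_fun hm ⟨y, hy⟩
  let b := Module.finBasis ℂ I
  let bd := B.dualBasis hBn b
  have hbd : ∀ x : I, ∑ j, B x (b j) • bd j = x := fun x => by
    conv_rhs => rw [← bd.sum_repr x]
    simp only [bd, LinearMap.BilinForm.dualBasis_repr_apply]
  have hb : ∀ x : I, ∑ j, B x (bd j) • b j = x := fun x => by
    have h : B.dualBasis hBn bd = b := LinearMap.BilinForm.dualBasis_dualBasis hBn hsymm b
    have hr := LinearMap.BilinForm.dualBasis_repr_apply hBn bd x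
    rw [h] at hr
    conv_rhs => rw [← b.sum_repr x]
    simp only [hr]
  have hinv : ∀ (z : L) (x y : I), B ⁅z, x⁆ y = - B x ⁅z, y⁆ := by
    intro z x y
    simp only [hB]
    exact traceForm_apply_lie_apply' ..
  let c : Module.End ℂ V := ∑ i, (toEnd ℂ L V (b i)) ∘ₗ (toEnd ℂ L V (bd i))
  have hc : ∀ v, c v = ∑ i, ⁅(b i : L), ⁅(bd i : L), v⁆⁆ := fun v => by simp [c]
  refine ⟨c, ?_, ?_, ?_⟩
  · intro z v
    have e1 : ⁅z, c v⁆ = ∑ i, (⁅((⁅z, b i⁆ : I) : L), ⁅(bd i : L), v⁆⁆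
        + ⁅(b i : L), ⁅((⁅z, bd i⁆ : I) : L), v⁆⁆) + c ⁅z, v⁆ := by
      rw [hc, hc, ← Finset.sum_add_distrib, lie_sum]
      refine Finset.sum_congr rfl fun i _ => ?_
      rw [leibniz_lie z, leibniz_lie z (bd i : L), lie_add, add_assoc]
      rfl
    rw [e1, Finset.sum_add_distrib, right_eq_add]
    have e2 : ∀ i, ⁅((⁅z, b i⁆ : I) : L), ⁅(bd i : L), v⁆⁆ =
        ∑ j, B ⁅z, b i⁆ (bd j) • ⁅(b j : L), ⁅(bd i : L), v⁆⁆ := by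
      intro i
      conv_lhs => rw [← hb ⁅z, b i⁆]
      simp only [AddSubmonoidClass.coe_finsetSum, LieSubmodule.coe_smul, sum_lie, smul_lie]
    have e3 : ∀ i, ⁅(b i : L), ⁅((⁅z, bd i⁆ : I) : L), v⁆⁆ =
        ∑ j, B ⁅z, bd i⁆ (b j) • ⁅(b i : L), ⁅(bd j : L), v⁆⁆ := by
      intro i
      conv_lhs => rw [← hbd ⁅z, bd i⁆]
      simp only [AddSubmonoidClass.coe_finsetSum, LieSubmodule.coe_smul, sum_lie, smul_lie, lie_sum, lie_smul]
    simp only [e2, e3]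
    rw [Finset.sum_comm, ← Finset.sum_add_distrib]
    refine Finset.sum_eq_zero fun i _ => ?_
    rw [← Finset.sum_add_distrib]
    refine Finset.sum_eq_zero fun j _ => ?_
    rw [hinv z (bd i) (b j), ← add_smul, show B (bd i) ⁅z, b j⁆ = B ⁅z, b j⁆ (bd i) from
      hsymm.eq _ _, add_neg_cancel, zero_smul]
  · simp only [c, map_sum]
    have : ∀ i, LinearMap.trace ℂ V ((toEnd ℂ L V (b i)) ∘ₗ (toEnd ℂ L V (bd i))) = 1 := by
      intro i
      have := LinearMap.BilinForm.apply_dualBasis_right hBn hsymm b i i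
      rw [if_pos rfl] at this
      exact this
    simp [this]
  · intro l hl v
    simp [hc, hl]


/-- Over a semisimple Lie algebra, the trace form of `V` is non-degenerate on some ideal `I` which
together with the elements acting trivially on `V` spans everything. -/
lemma exists_ideal {L : Type*} [LieRing L] [LieAlgebra ℂ L] [FiniteDimensional ℂ L]
    [HasTrivialRadical ℂ L]
    (V : Type*) [AddCommGroup V] [Module ℂ V] [LieRingModule L V] [LieModule ℂ L V]
    [FiniteDimensional ℂ V] :
    ∃ I : LieIdeal ℂ L, (∀ x ∈ I, (∀ y ∈ I, traceForm ℂ L V x y = 0) → x = 0) ∧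
      (I = ⊥ → ∀ (x : L) (v : V), ⁅x, v⁆ = 0) := by
  let k : LieIdeal ℂ L := (toEnd ℂ L V).ker
  have hk : ∀ x, x ∈ k ↔ ∀ v : V, ⁅x, v⁆ = 0 := fun x => by
    rw [LieHom.mem_ker]
    exact ⟨fun h v => LinearMap.congr_fun h v, fun h => LinearMap.ext h⟩
  let I : LieIdeal ℂ L := k.killingCompl
  have hcompl : IsCompl k I := LieIdeal.isCompl_killingCompl k
  have hdec : ∀ x : L, ∃ y ∈ k, ∃ z ∈ I, y + z = x := fun x => by
    have : x ∈ k ⊔ I := by rw [hcompl.sup_eq_top]; exact LieSubmodule.mem_top x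
    simpa [LieSubmodule.mem_sup] using this
  have hint : ∀ x, x ∈ k → x ∈ I → x = 0 := fun x h1 h2 => by
    have : x ∈ k ⊓ I := ⟨h1, h2⟩
    rw [hcompl.inf_eq_bot] at this
    simpa using this
  refine ⟨I, ?_, ?_⟩
  · let J : LieIdeal ℂ L :=
      { carrier := {x | x ∈ I ∧ ∀ y, traceForm ℂ L V x y = 0}
        add_mem' := fun {a b} ha hb => ⟨I.add_mem ha.1 hb.1, fun y => by
          rw [map_add, LinearMap.add_apply, ha.2, hb.2, add_zero]⟩
        zero_mem' := ⟨I.zero_mem, fun y => by simp⟩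
        smul_mem' := fun c a ha => ⟨I.smul_mem c ha.1, fun y => by
          rw [map_smul, LinearMap.smul_apply, ha.2, smul_zero]⟩
        lie_mem := fun {z a} ha => ⟨I.lie_mem ha.1, fun y => by
          rw [traceForm_apply_lie_apply', ha.2, neg_zero]⟩ }
    have hJI : ∀ x ∈ J, x ∈ I := fun x hx => hx.1
    have hJ0 : ∀ x ∈ J, ∀ y, traceForm ℂ L V x y = 0 := fun x hx => hx.2
    have htf : traceForm ℂ J V = 0 := by
      ext x y
      exact hJ0 x x.2 y
    have hnil := LieModule.isNilpotent_derivedSeries_of_traceForm_eq_zero htf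
    rw [LieModule.isNilpotent_iff_forall' (R := ℂ)] at hnil
    let D : LieIdeal ℂ L := ⁅J, J⁆
    have hDJ : D ≤ J := LieSubmodule.lie_le_left J J
    have hDnil : ∀ x ∈ D, IsNilpotent (toEnd ℂ L V x) := fun x hx => by
      refine hnil ⟨⟨x, hDJ hx⟩, ?_⟩
      rwa [LieIdeal.derivedSeries_eq_derivedSeriesOfIdeal_comap, LieIdeal.mem_comap]
    have hDN : LieRing.IsNilpotent D := by
      rw [LieAlgebra.isNilpotent_iff_forall (R := ℂ)]
      rintro ⟨x, hx⟩
      obtain ⟨n, hn⟩ := LieAlgebra.ad_nilpotent_of_nilpotent (R := ℂ) (hDnil x hx)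
      refine ⟨n, LinearMap.ext fun y => ?_⟩
      have key : ∀ n, toEnd ℂ L V (((ad ℂ D ⟨x, hx⟩ ^ n) y : D) : L) =
          (ad ℂ (Module.End ℂ V) (toEnd ℂ L V x) ^ n) (toEnd ℂ L V (y : L)) := by
        intro n
        induction n with
        | zero => rfl
        | succ n ih =>
          rw [pow_succ', pow_succ', Module.End.mul_apply, Module.End.mul_apply, ← ih]
          exact LieHom.map_lie (toEnd ℂ L V) _ _
      apply Subtype.ext
      refine hint _ ?_ (hJI _ (hDJ (Subtype.property _)))
      rw [hk]
      intro v
      have := key n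
      rw [hn] at this
      exact LinearMap.congr_fun this v
    have hD : D = ⊥ := HasTrivialRadical.eq_bot_of_isSolvable D
    have hJab : IsLieAbelian J := by
      rw [LieSubmodule.lie_abelian_iff_lie_self_eq_bot]
      exact hD
    have hJ : J = ⊥ := HasTrivialRadical.eq_bot_of_isSolvable J
    intro x hx hxy
    have : x ∈ J := by
      refine ⟨hx, fun y => ?_⟩
      obtain ⟨u, hu, w, hw, rfl⟩ := hdec y
      rw [map_add, hxy w hw, add_zero, traceForm_apply_apply]
      have : toEnd ℂ L V u = 0 := hu
      rw [this, LinearMap.comp_zero, map_zero]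
    rw [hJ] at this
    simpa using this
  · intro hI x
    rw [← hk]
    obtain ⟨u, hu, w, hw, rfl⟩ := hdec x
    rw [hI] at hw
    have : w = 0 := by simpa using hw
    rwa [this, add_zero]

/-- A form of Whitehead's first lemma. -/
lemma whitehead {L : Type*} [LieRing L] [LieAlgebra ℂ L] [FiniteDimensional ℂ L]
    [HasTrivialRadical ℂ L] (n : ℕ) :
    ∀ (V : Type _) [AddCommGroup V] [Module ℂ V] [LieRingModule L V] [LieModule ℂ L V]
    [FiniteDimensional ℂ V] (l : V →ₗ[ℂ] ℂ), Module.finrank ℂ V ≤ n → l ≠ 0 →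
    (∀ (x : L) (v : V), l ⁅x, v⁆ = 0) → ∃ v, l v ≠ 0 ∧ ∀ x : L, ⁅x, v⁆ = 0 := by
  induction n with
  | zero =>
    intro V _ _ _ _ _ l h hl _
    have : Subsingleton V := Module.finrank_zero_iff.mp (Nat.le_zero.mp h)
    exact absurd (LinearMap.ext fun v => by rw [Subsingleton.elim v 0]; simp) hl
  | succ n ih =>
    intro V _ _ _ _ _ l h hl hlx
    obtain ⟨I, hnd, hI⟩ := exists_ideal (L := L) V
    by_cases hbot : I = ⊥
    · obtain ⟨v, hv⟩ := DFunLike.ne_iff.mp hl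
      exact ⟨v, hv, fun x => hI hbot x v⟩
    obtain ⟨c, hcomm, htr, hlc⟩ := exists_casimir (V := V) I hnd
    have hfr : Module.finrank ℂ I ≠ 0 := by
      intro h0
      apply hbot
      rw [← LieSubmodule.toSubmodule_eq_bot]
      exact Submodule.finrank_eq_zero.mp h0
    have hcn : ∀ m, c ^ m ≠ 0 := fun m hm => by
      have := (LinearMap.isNilpotent_trace_of_isNilpotent (R := ℂ) (M := V) ⟨m, hm⟩).eq_zero
      rw [htr] at this
      exact hfr (by exact_mod_cast this)
    obtain ⟨m, hm⟩ := Filter.eventually_atTop.mp c.eventually_isCompl_ker_pow_range_pow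
    replace hm := hm (m + 1) (Nat.le_succ m)
    have hcm : ∀ (m : ℕ) (z : L) (v : V), (c ^ m) ⁅z, v⁆ = ⁅z, (c ^ m) v⁆ := by
      intro m z v
      induction m with
      | zero => rfl
      | succ m ihm => rw [pow_succ', Module.End.mul_apply, Module.End.mul_apply, ihm, hcomm]
    let V0 : LieSubmodule ℂ L V :=
      { LinearMap.ker (c ^ (m + 1)) with
        lie_mem := fun {z v} hv => by
          have hv' : (c ^ (m + 1)) v = 0 := hv
          change (c ^ (m + 1)) ⁅z, v⁆ = 0
          rw [hcm, hv', lie_zero] }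
    have hV0 : V0.toSubmodule = LinearMap.ker (c ^ (m + 1)) := rfl
    have hlt : Module.finrank ℂ V0 < Module.finrank ℂ V := by
      apply Submodule.finrank_lt (s := V0.toSubmodule)
      intro htop
      rw [hV0, LinearMap.ker_eq_top] at htop
      exact hcn _ htop
    obtain ⟨⟨v, hv⟩, hv1, hv2⟩ := ih V0 (l ∘ₗ V0.toSubmodule.subtype) (by omega) (by
      intro h0
      apply hl
      ext w
      have : w ∈ LinearMap.ker (c ^ (m + 1)) ⊔ LinearMap.range (c ^ (m + 1)) := by
        rw [hm.sup_eq_top]; trivial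
      obtain ⟨a, ha, b, ⟨d, rfl⟩, rfl⟩ := Submodule.mem_sup.mp this
      have h1 : l a = 0 := LinearMap.congr_fun h0 (⟨a, ha⟩ : V0)
      rw [map_add, h1, pow_succ', Module.End.mul_apply, hlc l hlx]
      simp) (fun x v => hlx x v)
    refine ⟨v, hv1, fun x => ?_⟩
    exact congrArg Subtype.val (hv2 x)


lemma quotient_trivial_radical (L : Type*) [LieRing L] [LieAlgebra ℂ L] [FiniteDimensional ℂ L] :
    HasTrivialRadical ℂ (L ⧸ radical ℂ L) := by
  rw [hasTrivialRadical_iff_no_abelian_ideals]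
  intro J hJ
  rw [LieSubmodule.lie_abelian_iff_lie_self_eq_bot] at hJ
  let K : LieIdeal ℂ L :=
    { carrier := {x | (LieSubmodule.Quotient.mk x : L ⧸ radical ℂ L) ∈ J}
      add_mem' := fun {a b} ha hb => J.add_mem ha hb
      zero_mem' := J.zero_mem
      smul_mem' := fun c a ha => J.smul_mem c ha
      lie_mem := fun {z a} ha => by
        change (LieSubmodule.Quotient.mk ⁅z, a⁆ : L ⧸ radical ℂ L) ∈ J
        rw [LieSubmodule.Quotient.mk_bracket]
        exact J.lie_mem ha }
  have hK : ∀ x, x ∈ K ↔ (LieSubmodule.Quotient.mk x : L ⧸ radical ℂ L) ∈ J := fun _ => Iff.rfl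
  have hKK : (⁅K, K⁆ : LieIdeal ℂ L) ≤ radical ℂ L := by
    rw [LieSubmodule.lieIdeal_oper_eq_span, LieSubmodule.lieSpan_le]
    rintro _ ⟨⟨a, ha⟩, ⟨b, hb⟩, rfl⟩
    have : ⁅(LieSubmodule.Quotient.mk a : L ⧸ radical ℂ L),
        (LieSubmodule.Quotient.mk b : L ⧸ radical ℂ L)⁆ ∈ (⁅J, J⁆ : LieIdeal ℂ _) :=
      LieSubmodule.lie_mem_lie ha hb
    rw [hJ, ← LieSubmodule.Quotient.mk_bracket, LieSubmodule.mem_bot] at this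
    exact LieSubmodule.Quotient.mk_eq_zero'.mp this
  have hs : IsSolvable (⁅K, K⁆ : LieIdeal ℂ L) := le_solvable_ideal_solvable hKK inferInstance
  obtain ⟨k, hk⟩ := IsSolvable.solvable ℂ (⁅K, K⁆ : LieIdeal ℂ L)
  rw [LieIdeal.derivedSeries_eq_bot_iff] at hk
  have hKs : IsSolvable K := by
    refine IsSolvable.mk (R := ℂ) (k := k + 1) ((LieIdeal.derivedSeries_eq_bot_iff K (k + 1)).mpr ?_)
    rwa [derivedSeriesOfIdeal_add, derivedSeriesOfIdeal_succ, derivedSeriesOfIdeal_zero]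
  have hKr := (LieIdeal.solvable_iff_le_radical ℂ L K).mp hKs
  rw [LieSubmodule.eq_bot_iff]
  intro q hq
  obtain ⟨x, rfl⟩ := LieSubmodule.Quotient.surjective_mk' _ q
  exact LieSubmodule.Quotient.mk_eq_zero'.mpr (hKr hq)

lemma whitehead' {L : Type*} [LieRing L] [LieAlgebra ℂ L] [FiniteDimensional ℂ L]
    (V : Type*) [AddCommGroup V] [Module ℂ V] [LieRingModule L V] [LieModule ℂ L V]
    [FiniteDimensional ℂ V] (l : V →ₗ[ℂ] ℂ) (hl : l ≠ 0)
    (hlx : ∀ (x : L) (v : V), l ⁅x, v⁆ = 0)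
    (hr : ∀ x ∈ radical ℂ L, ∀ v : V, ⁅x, v⁆ = 0) :
    ∃ v, l v ≠ 0 ∧ ∀ x : L, ⁅x, v⁆ = 0 := by
  have := quotient_trivial_radical L
  let f : (L ⧸ radical ℂ L) →ₗ[ℂ] Module.End ℂ V :=
    (radical ℂ L).toSubmodule.liftQ (toEnd ℂ L V : L →ₗ[ℂ] Module.End ℂ V) (fun x hx => by
      rw [LinearMap.mem_ker]
      exact LinearMap.ext (hr x hx))
  have hf : ∀ x : L, f (LieSubmodule.Quotient.mk x) = toEnd ℂ L V x := fun x => rfl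
  let φ : (L ⧸ radical ℂ L) →ₗ⁅ℂ⁆ Module.End ℂ V :=
    { f with
      map_lie' := fun {a b} => by
        obtain ⟨x, rfl⟩ := LieSubmodule.Quotient.surjective_mk' _ a
        obtain ⟨y, rfl⟩ := LieSubmodule.Quotient.surjective_mk' _ b
        exact LieHom.map_lie (toEnd ℂ L V) x y }
  let i1 : LieRingModule (L ⧸ radical ℂ L) V := LieRingModule.compLieHom V φ
  let i2 : LieModule ℂ (L ⧸ radical ℂ L) V := LieModule.compLieHom V φ
  have hact : ∀ (x : L) (v : V), ⁅(LieSubmodule.Quotient.mk x : L ⧸ radical ℂ L), v⁆ = ⁅x, v⁆ :=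
    fun x v => rfl
  have : FiniteDimensional ℂ (L ⧸ radical ℂ L) :=
    inferInstanceAs (FiniteDimensional ℂ (L ⧸ (radical ℂ L).toSubmodule))
  obtain ⟨v, hv1, hv2⟩ := whitehead (L := L ⧸ radical ℂ L) _ V l le_rfl hl (fun q v => by
    obtain ⟨x, rfl⟩ := LieSubmodule.Quotient.surjective_mk' _ q
    exact hlx x v)
  exact ⟨v, hv1, fun x => hv2 (LieSubmodule.Quotient.mk x)⟩

/-- If the radical is abelian and non-zero, there is an endomorphism `f` with values in the radical,
scalar on the radical, which is invariant up to inner derivations by the radical. -/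
lemma exists_endo {L : Type*} [LieRing L] [LieAlgebra ℂ L] [FiniteDimensional ℂ L]
    (hab : ∀ x ∈ radical ℂ L, ∀ y ∈ radical ℂ L, ⁅x, y⁆ = 0) (hne : radical ℂ L ≠ ⊥) :
    ∃ (f : L →ₗ[ℂ] L) (c : ℂ), c ≠ 0 ∧ (∀ y, f y ∈ radical ℂ L) ∧
      (∀ y ∈ radical ℂ L, f y = c • y) ∧
      ∀ x : L, ∃ a ∈ radical ℂ L, ∀ y : L, ⁅x, f y⁆ - f ⁅x, y⁆ = ⁅a, y⁆ := by
  let r := radical ℂ L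
  let M : LieSubmodule ℂ L (L →ₗ[ℂ] L) :=
    { carrier := {f | (∀ y, f y ∈ r) ∧ ∃ c : ℂ, ∀ y ∈ r, f y = c • y}
      add_mem' := by
        rintro f g ⟨hf, c, hc⟩ ⟨hg, d, hd⟩
        refine ⟨fun y => r.add_mem (hf y) (hg y), c + d, fun y hy => ?_⟩
        rw [LinearMap.add_apply, hc y hy, hd y hy, add_smul]
      zero_mem' := ⟨fun y => r.zero_mem, 0, fun y _ => by simp⟩
      smul_mem' := by
        rintro t f ⟨hf, c, hc⟩
        refine ⟨fun y => r.smul_mem t (hf y), t * c, fun y hy => ?_⟩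
        rw [LinearMap.smul_apply, hc y hy, mul_smul]
      lie_mem := by
        rintro x f ⟨hf, c, hc⟩
        refine ⟨fun y => ?_, 0, fun y hy => ?_⟩
        · rw [LieHom.lie_apply]
          exact r.sub_mem (r.lie_mem (hf y)) (hf _)
        · rw [LieHom.lie_apply, hc y hy, hc _ (r.lie_mem hy), lie_smul, sub_self, zero_smul] }
  have hM : ∀ f : L →ₗ[ℂ] L, f ∈ M ↔ (∀ y, f y ∈ r) ∧ ∃ c : ℂ, ∀ y ∈ r, f y = c • y :=
    fun _ => Iff.rfl
  have hbr : ∀ (x : L) (f : M) (y : L), (⁅x, f⁆ : M).1 y = ⁅x, f.1 y⁆ - f.1 ⁅x, y⁆ :=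
    fun x f y => LieHom.lie_apply ..
  let P : LieSubmodule ℂ L M :=
    { carrier := {f | ∃ a ∈ r, ∀ y, f.1 y = ⁅a, y⁆}
      add_mem' := by
        rintro f g ⟨a, ha, hfa⟩ ⟨b, hb, hgb⟩
        refine ⟨a + b, r.add_mem ha hb, fun y => ?_⟩
        rw [add_lie, ← hfa, ← hgb]; rfl
      zero_mem' := ⟨0, r.zero_mem, fun y => by simp⟩
      smul_mem' := by
        rintro t f ⟨a, ha, hfa⟩
        refine ⟨t • a, r.smul_mem t ha, fun y => ?_⟩
        rw [smul_lie, ← hfa]; rfl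
      lie_mem := by
        rintro x f ⟨a, ha, hfa⟩
        refine ⟨⁅x, a⁆, r.lie_mem ha, fun y => ?_⟩
        rw [hbr, hfa, hfa, lie_lie] }
  have hP : ∀ f : M, f ∈ P ↔ ∃ a ∈ r, ∀ y, f.1 y = ⁅a, y⁆ := fun _ => Iff.rfl
  obtain ⟨r0, hr0, hr0'⟩ : ∃ r0 ∈ r, r0 ≠ 0 := by
    by_contra! hcon
    exact hne ((LieSubmodule.eq_bot_iff _).mpr hcon)
  obtain ⟨η, hη⟩ := Module.Projective.exists_dual_ne_zero ℂ hr0'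
  let l0 : M →ₗ[ℂ] ℂ := η ∘ₗ (LinearMap.applyₗ r0) ∘ₗ M.toSubmodule.subtype
  have hl0 : ∀ f : M, l0 f = η (f.1 r0) := fun _ => rfl
  let l : (M ⧸ P) →ₗ[ℂ] ℂ := P.toSubmodule.liftQ l0 (by
    rintro f ⟨a, ha, hfa⟩
    rw [LinearMap.mem_ker, hl0, hfa, hab a ha r0 hr0, map_zero])
  have hlmk : ∀ f : M, l (LieSubmodule.Quotient.mk f) = η (f.1 r0) := fun _ => rfl
  have : FiniteDimensional ℂ (M ⧸ P) := inferInstanceAs (FiniteDimensional ℂ (M ⧸ P.toSubmodule))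
  obtain ⟨v, hv1, hv2⟩ := whitehead' (L := L) (M ⧸ P) l (by
      obtain ⟨p, hp⟩ := r.toSubmodule.exists_isCompl
      let g : L →ₗ[ℂ] L := r.toSubmodule.subtype ∘ₗ r.toSubmodule.projectionOnto p hp
      have hg : ∀ y ∈ r, g y = y := fun y hy => by
        have := Submodule.projectionOnto_apply_left hp ⟨y, hy⟩
        exact congrArg Subtype.val this
      have hgM : g ∈ M := ⟨fun y => Subtype.property _, 1, fun y hy => by rw [hg y hy, one_smul]⟩
      intro h0
      have := LinearMap.congr_fun h0 (LieSubmodule.Quotient.mk ⟨g, hgM⟩)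
      rw [hlmk] at this
      apply hη
      simpa [hg r0 hr0] using this) (fun x q => by
      obtain ⟨f, rfl⟩ := LieSubmodule.Quotient.surjective_mk' _ q
      change l (LieSubmodule.Quotient.mk ⁅x, f⁆) = 0
      rw [hlmk, hbr]
      obtain ⟨-, c, hc⟩ := (hM f.1).mp f.2
      rw [hc _ hr0, hc _ (r.lie_mem hr0), lie_smul, sub_self, map_zero]) (fun x hx q => by
      obtain ⟨f, rfl⟩ := LieSubmodule.Quotient.surjective_mk' _ q
      change (LieSubmodule.Quotient.mk ⁅x, f⁆ : M ⧸ P) = 0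
      rw [LieSubmodule.Quotient.mk_eq_zero', hP]
      obtain ⟨hf, c, hc⟩ := (hM f.1).mp f.2
      refine ⟨-(c • x), r.neg_mem (r.smul_mem c hx), fun y => ?_⟩
      rw [hbr, hab x hx _ (hf y), hc _ (lie_mem_left ℂ L r x y hx), neg_lie, smul_lie, zero_sub])
  obtain ⟨f, rfl⟩ := LieSubmodule.Quotient.surjective_mk' _ v
  obtain ⟨hf, c, hc⟩ := (hM f.1).mp f.2
  refine ⟨f.1, c, ?_, hf, hc, fun x => ?_⟩
  · rintro rfl
    apply hv1
    change l (LieSubmodule.Quotient.mk f) = 0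
    rw [hlmk, hc r0 hr0, zero_smul, map_zero]
  · have h1 : (LieSubmodule.Quotient.mk ⁅x, f⁆ : M ⧸ P) = 0 := hv2 x
    rw [LieSubmodule.Quotient.mk_eq_zero', hP] at h1
    obtain ⟨a, ha, haf⟩ := h1
    exact ⟨a, ha, fun y => by rw [← hbr, haf]⟩

lemma not_abelian {L : Type*} [LieRing L] [LieAlgebra ℂ L] [FiniteDimensional ℂ L]
    (hperf : ⁅(⊤ : LieIdeal ℂ L), (⊤ : LieIdeal ℂ L)⁆ = ⊤)
    (hcenter : LieAlgebra.center ℂ L = ⊥)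
    (hinner : ∀ D : LieDerivation ℂ L L, ∃ x : L, ∀ y : L, D y = ⁅x, y⁆)
    (hab : ∀ x ∈ radical ℂ L, ∀ y ∈ radical ℂ L, ⁅x, y⁆ = 0) (hne : radical ℂ L ≠ ⊥) :
    False := by
  obtain ⟨f, c, hc0, hf, hfc, hx⟩ := exists_endo hab hne
  choose a har ha using hx
  have hinj : ∀ x z : L, (∀ y : L, ⁅x, y⁆ = ⁅z, y⁆) → x = z := by
    intro x z h
    have : x - z ∈ center ℂ L := by
      rw [LieModule.mem_maxTrivSubmodule]
      intro y
      rw [← lie_skew, sub_lie, h, sub_self, neg_zero]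
    rw [hcenter, LieSubmodule.mem_bot] at this
    exact sub_eq_zero.mp this
  let A : L →ₗ[ℂ] L :=
    { toFun := a
      map_add' := fun x z => hinj _ _ fun y => by
        rw [add_lie, ← ha, ← ha, ← ha, add_lie, add_lie, map_add]; abel
      map_smul' := fun t x => hinj _ _ fun y => by
        rw [RingHom.id_apply, smul_lie, ← ha, ← ha, smul_lie, smul_lie, map_smul, smul_sub] }
  let D : LieDerivation ℂ L L :=
    { A with
      leibniz' := fun x z => by
        apply hinj
        intro y
        change ⁅a ⁅x, z⁆, y⁆ = ⁅⁅x, a z⁆ - ⁅z, a x⁆, y⁆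
        simp only [sub_lie, lie_lie, ← ha, map_sub, lie_sub]
        abel }
  obtain ⟨w, hw⟩ := hinner D
  have hDa : ∀ y, a y = ⁅w, y⁆ := hw
  have har' : ∀ y ∈ radical ℂ L, a y = -(c • y) := fun y hy => hinj _ _ fun z => by
    rw [← ha, hab y hy _ (hf z), hfc _ (lie_mem_left ℂ L _ y z hy), neg_lie, smul_lie, zero_sub]
  have hproj : LinearMap.IsProj (radical ℂ L).toSubmodule ((-c⁻¹) • toEnd ℂ L L w) := by
    refine ⟨fun y => ?_, fun y hy => ?_⟩
    · apply Submodule.smul_mem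
      change ⁅w, y⁆ ∈ radical ℂ L
      rw [← hDa]
      exact har y
    · change (-c⁻¹) • ⁅w, y⁆ = y
      rw [← hDa, har' y hy, smul_neg, neg_smul, neg_neg, smul_smul, inv_mul_cancel₀ hc0, one_smul]
  have ht := hproj.trace
  rw [map_smul, trace_zero hperf, smul_zero] at ht
  have h0 : Module.finrank ℂ (radical ℂ L).toSubmodule = 0 := by exact_mod_cast ht.symm
  apply hne
  rw [← LieSubmodule.toSubmodule_eq_bot]
  exact Submodule.finrank_eq_zero.mp h0

end RadAux

/-- The solvable radical of a non-trivial, perfect, complete, non-semisimple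
finite-dimensional complex Lie algebra is nilpotent and non-abelian. -/
theorem radical_nilpotent_nonabelian
    (L : Type*) [LieRing L] [LieAlgebra ℂ L] [FiniteDimensional ℂ L] [Nontrivial L]
    (hperf : ⁅(⊤ : LieIdeal ℂ L), (⊤ : LieIdeal ℂ L)⁆ = ⊤)
    (hcenter : LieAlgebra.center ℂ L = ⊥)
    (hinner : ∀ D : LieDerivation ℂ L L, ∃ x : L, ∀ y : L, D y = ⁅x, y⁆)
    (hnotss : ¬ LieAlgebra.IsSemisimple ℂ L) :
    LieRing.IsNilpotent (LieAlgebra.radical ℂ L) ∧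
      ¬ IsLieAbelian (LieAlgebra.radical ℂ L) := by
  refine ⟨RadAux.radical_nilpotent hperf, fun hab => ?_⟩
  refine RadAux.not_abelian hperf hcenter hinner ?_ ?_
  · intro x hx y hy
    exact congrArg Subtype.val (hab.trivial ⟨x, hx⟩ ⟨y, hy⟩)
  · intro h
    have : LieAlgebra.HasTrivialRadical ℂ L := ⟨h⟩
    exact hnotss inferInstance
end
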